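/- For every valid online rotation strategy σ, every function f : ℝ → ℝ, and every real c > 0, there exists a nonempty finite stream L of pieces such that OPT(L) = c and ALG_σ(L) > f(OPT(L))·OPT(L), where the cost is the area of the bounding box. In particular, no online algorithm for area minimization with rotations allowed has a competitive ratio bounded by any function of OPT. -/

import Mathlib

open Set

/-- A piece is a pair (w,h) of (intended positive) real numbers. -/
abbrev Piece := ℝ × ℝ

/-- Both edge lengths of the piece are positive. -/
def PiecePos (p : Piece) : Prop := 0 < p.1 ∧ 0 < p.2

/-- The axis-parallel closed rectangle obtained by placing piece `p` by
translation at the point `q`. -/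
def placedRect (p : Piece) (q : ℝ × ℝ) : Set (ℝ × ℝ) :=
  Set.Icc q.1 (q.1 + p.1) ×ˢ Set.Icc q.2 (q.2 + p.2)

/-- Width of the axis-parallel bounding box of a set in the plane. -/
noncomputable def boxWidth (S : Set (ℝ × ℝ)) : ℝ :=
  sSup (Prod.fst '' S) - sInf (Prod.fst '' S)

/-- Height of the axis-parallel bounding box of a set in the plane. -/
noncomputable def boxHeight (S : Set (ℝ × ℝ)) : ℝ :=
  sSup (Prod.snd '' S) - sInf (Prod.snd '' S)

/-! ### Translations only -/

/-- `pos` is a packing (by translations) of the list `L` of pieces: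
the placed rectangles have pairwise disjoint interiors. -/
def IsPacking (L : List Piece) (pos : Fin L.length → ℝ × ℝ) : Prop :=
  ∀ i j : Fin L.length, i ≠ j →
    Disjoint (interior (placedRect (L.get i) (pos i)))
             (interior (placedRect (L.get j) (pos j)))

/-- The union of the placed rectangles. -/
def packedSet (L : List Piece) (pos : Fin L.length → ℝ × ℝ) : Set (ℝ × ℝ) :=
  ⋃ i : Fin L.length, placedRect (L.get i) (pos i)

/-- Perimeter of the bounding box of a packing. -/
noncomputable def periCost (L : List Piece) (pos : Fin L.length → ℝ × ℝ) : ℝ :=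
  2 * (boxWidth (packedSet L pos) + boxHeight (packedSet L pos))

/-- Area of the bounding box of a packing. -/
noncomputable def areaCost (L : List Piece) (pos : Fin L.length → ℝ × ℝ) : ℝ :=
  boxWidth (packedSet L pos) * boxHeight (packedSet L pos)

/-- Optimal offline bounding-box perimeter for the pieces of `L`. -/
noncomputable def optPeri (L : List Piece) : ℝ :=
  sInf { c | ∃ pos : Fin L.length → ℝ × ℝ, IsPacking L pos ∧ periCost L pos = c }

/-- Optimal offline bounding-box area for the pieces of `L`. -/
noncomputable def optArea (L : List Piece) : ℝ :=
  sInf { c | ∃ pos : Fin L.length → ℝ × ℝ, IsPacking L pos ∧ areaCost L pos = c }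

/-- The positions chosen by the online strategy `σ` on the stream `L`:
the `i`-th piece is placed at the point chosen by `σ` as a function of the
first `i+1` pieces. -/
def onlinePos (σ : List Piece → ℝ × ℝ) (L : List Piece) :
    Fin L.length → ℝ × ℝ :=
  fun i => σ (L.take ((i : ℕ) + 1))

/-- `σ` is a valid online translation strategy: on every stream of pieces it
produces a packing. -/
def StrategyValid (σ : List Piece → ℝ × ℝ) : Prop :=
  ∀ L : List Piece, (∀ p ∈ L, PiecePos p) → IsPacking L (onlinePos σ L)

/-- Perimeter of the bounding box of the packing produced by `σ` on `L`. -/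
noncomputable def algPeri (σ : List Piece → ℝ × ℝ) (L : List Piece) : ℝ :=
  periCost L (onlinePos σ L)

/-- Area of the bounding box of the packing produced by `σ` on `L`. -/
noncomputable def algArea (σ : List Piece → ℝ × ℝ) (L : List Piece) : ℝ :=
  areaCost L (onlinePos σ L)

/-! ### Rotations by 90° allowed -/

/-- The piece `p` in the orientation given by `r`: rotated by 90° if `r` is
`true`. -/
def orient (p : Piece) (r : Bool) : Piece := if r then (p.2, p.1) else p

/-- `pos, rot` is a packing with rotations of the list `L` of pieces. -/
def IsRotPacking (L : List Piece) (pos : Fin L.length → ℝ × ℝ)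
    (rot : Fin L.length → Bool) : Prop :=
  ∀ i j : Fin L.length, i ≠ j →
    Disjoint (interior (placedRect (orient (L.get i) (rot i)) (pos i)))
             (interior (placedRect (orient (L.get j) (rot j)) (pos j)))

/-- The union of the placed (possibly rotated) rectangles. -/
def packedRotSet (L : List Piece) (pos : Fin L.length → ℝ × ℝ)
    (rot : Fin L.length → Bool) : Set (ℝ × ℝ) :=
  ⋃ i : Fin L.length, placedRect (orient (L.get i) (rot i)) (pos i)

/-- Perimeter of the bounding box of a packing with rotations. -/
noncomputable def periRotCost (L : List Piece) (pos : Fin L.length → ℝ × ℝ)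
    (rot : Fin L.length → Bool) : ℝ :=
  2 * (boxWidth (packedRotSet L pos rot) + boxHeight (packedRotSet L pos rot))

/-- Area of the bounding box of a packing with rotations. -/
noncomputable def areaRotCost (L : List Piece) (pos : Fin L.length → ℝ × ℝ)
    (rot : Fin L.length → Bool) : ℝ :=
  boxWidth (packedRotSet L pos rot) * boxHeight (packedRotSet L pos rot)

/-- Optimal offline bounding-box perimeter with rotations allowed. -/
noncomputable def optRotPeri (L : List Piece) : ℝ :=
  sInf { c | ∃ (pos : Fin L.length → ℝ × ℝ) (rot : Fin L.length → Bool),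
    IsRotPacking L pos rot ∧ periRotCost L pos rot = c }

/-- Optimal offline bounding-box area with rotations allowed. -/
noncomputable def optRotArea (L : List Piece) : ℝ :=
  sInf { c | ∃ (pos : Fin L.length → ℝ × ℝ) (rot : Fin L.length → Bool),
    IsRotPacking L pos rot ∧ areaRotCost L pos rot = c }

/-- The positions chosen by the online rotation strategy `σ` on the stream `L`. -/
def onlineRotPos (σ : List Piece → (ℝ × ℝ) × Bool) (L : List Piece) :
    Fin L.length → ℝ × ℝ :=
  fun i => (σ (L.take ((i : ℕ) + 1))).1

/-- The orientations chosen by the online rotation strategy `σ` on the stream `L`. -/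
def onlineRot (σ : List Piece → (ℝ × ℝ) × Bool) (L : List Piece) :
    Fin L.length → Bool :=
  fun i => (σ (L.take ((i : ℕ) + 1))).2

/-- `σ` is a valid online rotation strategy: on every stream of pieces it
produces a packing with rotations. -/
def RotStrategyValid (σ : List Piece → (ℝ × ℝ) × Bool) : Prop :=
  ∀ L : List Piece, (∀ p ∈ L, PiecePos p) →
    IsRotPacking L (onlineRotPos σ L) (onlineRot σ L)

/-- Perimeter of the bounding box of the packing produced by `σ` on `L`. -/
noncomputable def algRotPeri (σ : List Piece → (ℝ × ℝ) × Bool) (L : List Piece) : ℝ :=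
  periRotCost L (onlineRotPos σ L) (onlineRot σ L)

/-- Area of the bounding box of the packing produced by `σ` on `L`. -/
noncomputable def algRotArea (σ : List Piece → (ℝ × ℝ) × Bool) (L : List Piece) : ℝ :=
  areaRotCost L (onlineRotPos σ L) (onlineRot σ L)

/-! ### Square pieces, bounding-square cost -/

/-- The axis-parallel closed square of side `s` placed at the point `q`. -/
def placedSq (s : ℝ) (q : ℝ × ℝ) : Set (ℝ × ℝ) :=
  Set.Icc q.1 (q.1 + s) ×ˢ Set.Icc q.2 (q.2 + s)

/-- `pos` is a packing of the list `L` of square pieces. -/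
def IsSqPacking (L : List ℝ) (pos : Fin L.length → ℝ × ℝ) : Prop :=
  ∀ i j : Fin L.length, i ≠ j →
    Disjoint (interior (placedSq (L.get i) (pos i)))
             (interior (placedSq (L.get j) (pos j)))

/-- The union of the placed squares. -/
def packedSqSet (L : List ℝ) (pos : Fin L.length → ℝ × ℝ) : Set (ℝ × ℝ) :=
  ⋃ i : Fin L.length, placedSq (L.get i) (pos i)

/-- Area of the smallest axis-parallel square containing all placed squares. -/
noncomputable def sqCost (L : List ℝ) (pos : Fin L.length → ℝ × ℝ) : ℝ :=
  (max (boxWidth (packedSqSet L pos)) (boxHeight (packedSqSet L pos))) ^ 2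

/-- Optimal offline bounding-square area for the square pieces of `L`. -/
noncomputable def optSq (L : List ℝ) : ℝ :=
  sInf { c | ∃ pos : Fin L.length → ℝ × ℝ, IsSqPacking L pos ∧ sqCost L pos = c }

/-- The positions chosen by the online strategy `σ` on the stream `L` of
square pieces. -/
def onlineSqPos (σ : List ℝ → ℝ × ℝ) (L : List ℝ) : Fin L.length → ℝ × ℝ :=
  fun i => σ (L.take ((i : ℕ) + 1))

/-- `σ` is a valid online translation strategy for square pieces. -/
def SqStrategyValid (σ : List ℝ → ℝ × ℝ) : Prop :=
  ∀ L : List ℝ, (∀ s ∈ L, 0 < s) → IsSqPacking L (onlineSqPos σ L)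

/-- Bounding-square area of the packing produced by `σ` on `L`. -/
noncomputable def algSq (σ : List ℝ → ℝ × ℝ) (L : List ℝ) : ℝ :=
  sqCost L (onlineSqPos σ L)

/-! ### Bounding boxes of compact sets -/

theorem isCompact_placedRect (p : Piece) (q : ℝ × ℝ) : IsCompact (placedRect p q) :=
  isCompact_Icc.prod isCompact_Icc

theorem nonempty_placedRect {p : Piece} (hp : PiecePos p) (q : ℝ × ℝ) :
    (placedRect p q).Nonempty :=
  ⟨q, ⟨⟨le_rfl, by linarith [hp.1]⟩, ⟨le_rfl, by linarith [hp.2]⟩⟩⟩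

theorem boxWidth_mono {S T : Set (ℝ × ℝ)} (hS : S.Nonempty) (hT : IsCompact T) (h : S ⊆ T) :
    boxWidth S ≤ boxWidth T :=
  sub_le_sub
    (csSup_le_csSup (hT.image continuous_fst).bddAbove (hS.image _) (image_mono h))
    (csInf_le_csInf (hT.image continuous_fst).bddBelow (hS.image _) (image_mono h))

theorem boxHeight_mono {S T : Set (ℝ × ℝ)} (hS : S.Nonempty) (hT : IsCompact T) (h : S ⊆ T) :
    boxHeight S ≤ boxHeight T :=
  sub_le_sub
    (csSup_le_csSup (hT.image continuous_snd).bddAbove (hS.image _) (image_mono h))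
    (csInf_le_csInf (hT.image continuous_snd).bddBelow (hS.image _) (image_mono h))

theorem boxWidth_placedRect {p : Piece} (hp : PiecePos p) (q : ℝ × ℝ) :
    boxWidth (placedRect p q) = p.1 := by
  have h1 : q.1 ≤ q.1 + p.1 := by linarith [hp.1]
  have h2 : q.2 ≤ q.2 + p.2 := by linarith [hp.2]
  rw [boxWidth, placedRect, fst_image_prod _ (nonempty_Icc.2 h2), csSup_Icc h1, csInf_Icc h1]
  ring

theorem boxHeight_placedRect {p : Piece} (hp : PiecePos p) (q : ℝ × ℝ) :
    boxHeight (placedRect p q) = p.2 := by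
  have h1 : q.1 ≤ q.1 + p.1 := by linarith [hp.1]
  have h2 : q.2 ≤ q.2 + p.2 := by linarith [hp.2]
  rw [boxHeight, placedRect, snd_image_prod (nonempty_Icc.2 h1), csSup_Icc h2, csInf_Icc h2]
  ring

theorem boxWidth_nonneg {S : Set (ℝ × ℝ)} (hS : IsCompact S) (hne : S.Nonempty) :
    0 ≤ boxWidth S :=
  sub_nonneg.2 <| csInf_le_csSup (hne.image _) (hS.image continuous_fst).bddBelow
    (hS.image continuous_fst).bddAbove

theorem boxHeight_nonneg {S : Set (ℝ × ℝ)} (hS : IsCompact S) (hne : S.Nonempty) :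
    0 ≤ boxHeight S :=
  sub_nonneg.2 <| csInf_le_csSup (hne.image _) (hS.image continuous_snd).bddBelow
    (hS.image continuous_snd).bddAbove

theorem subset_boundingBox {S : Set (ℝ × ℝ)} (hS : IsCompact S) :
    S ⊆ Icc (sInf (Prod.fst '' S)) (sSup (Prod.fst '' S)) ×ˢ
      Icc (sInf (Prod.snd '' S)) (sSup (Prod.snd '' S)) := fun _ hx =>
  ⟨⟨csInf_le (hS.image continuous_fst).bddBelow (mem_image_of_mem _ hx),
    le_csSup (hS.image continuous_fst).bddAbove (mem_image_of_mem _ hx)⟩,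
   ⟨csInf_le (hS.image continuous_snd).bddBelow (mem_image_of_mem _ hx),
    le_csSup (hS.image continuous_snd).bddAbove (mem_image_of_mem _ hx)⟩⟩

theorem volume_le_boxWidth_mul_boxHeight {S : Set (ℝ × ℝ)} (hS : IsCompact S)
    (hne : S.Nonempty) :
    MeasureTheory.volume S ≤ ENNReal.ofReal (boxWidth S * boxHeight S) := by
  refine (MeasureTheory.measure_mono (subset_boundingBox hS)).trans_eq ?_
  rw [MeasureTheory.Measure.volume_eq_prod, MeasureTheory.Measure.prod_prod, Real.volume_Icc,
    Real.volume_Icc, ENNReal.ofReal_mul (boxWidth_nonneg hS hne)]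
  rfl

/-! ### Packings with rotations -/

theorem interior_placedRect (p : Piece) (q : ℝ × ℝ) :
    interior (placedRect p q) = Ioo q.1 (q.1 + p.1) ×ˢ Ioo q.2 (q.2 + p.2) := by
  rw [placedRect, interior_prod_eq, interior_Icc, interior_Icc]

theorem volume_interior_placedRect {p : Piece} (hp : PiecePos p) (q : ℝ × ℝ) :
    MeasureTheory.volume (interior (placedRect p q)) = ENNReal.ofReal (p.1 * p.2) := by
  rw [interior_placedRect, MeasureTheory.Measure.volume_eq_prod,
    MeasureTheory.Measure.prod_prod, Real.volume_Ioo, Real.volume_Ioo,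
    ENNReal.ofReal_mul hp.1.le]
  simp

theorem PiecePos.orient {p : Piece} (hp : PiecePos p) (r : Bool) : PiecePos (orient p r) := by
  cases r
  · exact hp
  · exact ⟨hp.2, hp.1⟩

theorem orient_area (p : Piece) (r : Bool) : (orient p r).1 * (orient p r).2 = p.1 * p.2 := by
  cases r
  · rfl
  · exact mul_comm _ _

theorem isCompact_packedRotSet (L : List Piece) (pos : Fin L.length → ℝ × ℝ)
    (rot : Fin L.length → Bool) : IsCompact (packedRotSet L pos rot) :=
  isCompact_iUnion fun _ => isCompact_placedRect _ _

theorem nonempty_packedRotSet {L : List Piece} (hL : L ≠ []) (hp : ∀ p ∈ L, PiecePos p)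
    (pos : Fin L.length → ℝ × ℝ) (rot : Fin L.length → Bool) :
    (packedRotSet L pos rot).Nonempty := by
  let i : Fin L.length := ⟨0, List.length_pos_of_ne_nil hL⟩
  exact (nonempty_placedRect ((hp _ (L.get_mem i)).orient (rot i)) (pos i)).mono
    (subset_iUnion (fun i => placedRect (orient (L.get i) (rot i)) (pos i)) i)

/-- The bounding box of a packing is at least as large as the total area of the pieces. -/
theorem IsRotPacking.sum_area_le {L : List Piece} (hL : L ≠ []) (hp : ∀ p ∈ L, PiecePos p)
    {pos : Fin L.length → ℝ × ℝ} {rot : Fin L.length → Bool} (h : IsRotPacking L pos rot) :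
    (L.map fun p => p.1 * p.2).sum ≤ areaRotCost L pos rot := by
  have hc := isCompact_packedRotSet L pos rot
  have hne := nonempty_packedRotSet hL hp pos rot
  have hsum : (L.map fun p => p.1 * p.2).sum = ∑ i : Fin L.length, (L.get i).1 * (L.get i).2 := by
    conv_lhs => rw [← List.ofFn_get L]
    rw [List.map_ofFn, List.sum_ofFn]
    rfl
  refine (ENNReal.ofReal_le_ofReal_iff
    (mul_nonneg (boxWidth_nonneg hc hne) (boxHeight_nonneg hc hne))).1 ?_
  refine le_trans ?_ (volume_le_boxWidth_mul_boxHeight hc hne)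
  have hpos (i : Fin L.length) := hp _ (L.get_mem i)
  calc ENNReal.ofReal (L.map fun p => p.1 * p.2).sum
      = ∑ i : Fin L.length, MeasureTheory.volume
          (interior (placedRect (orient (L.get i) (rot i)) (pos i))) := by
        rw [hsum, ENNReal.ofReal_sum_of_nonneg
          fun i _ => mul_nonneg (hpos i).1.le (hpos i).2.le]
        refine Finset.sum_congr rfl fun i _ => ?_
        rw [volume_interior_placedRect ((hpos i).orient _), orient_area]
    _ = MeasureTheory.volume
          (⋃ i, interior (placedRect (orient (L.get i) (rot i)) (pos i))) := by
        rw [MeasureTheory.measure_iUnion (fun i j hij => h i j hij)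
          fun _ => isOpen_interior.measurableSet, tsum_fintype]
    _ ≤ MeasureTheory.volume (packedRotSet L pos rot) :=
        MeasureTheory.measure_mono (iUnion_mono fun _ => interior_subset)

/-- Pieces that perfectly tile a rectangle have that rectangle as optimal bounding box. -/
theorem optRotArea_eq_of_tiling {L : List Piece} (hL : L ≠ []) (hp : ∀ p ∈ L, PiecePos p)
    {pos : Fin L.length → ℝ × ℝ} {rot : Fin L.length → Bool} (h : IsRotPacking L pos rot)
    {b : Piece} (hb : PiecePos b) (q : ℝ × ℝ) (hsub : packedRotSet L pos rot ⊆ placedRect b q)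
    (harea : (L.map fun p => p.1 * p.2).sum = b.1 * b.2) :
    optRotArea L = b.1 * b.2 := by
  have hne := nonempty_packedRotSet hL hp pos rot
  have hle : areaRotCost L pos rot ≤ b.1 * b.2 := by
    refine mul_le_mul ?_ ?_ (boxHeight_nonneg (isCompact_packedRotSet _ _ _) hne) hb.1.le
    · exact (boxWidth_mono hne (isCompact_placedRect _ _) hsub).trans_eq (boxWidth_placedRect hb q)
    · exact (boxHeight_mono hne (isCompact_placedRect _ _) hsub).trans_eq
        (boxHeight_placedRect hb q)
  have hlb : b.1 * b.2 ∈ lowerBounds { c | ∃ (pos : Fin L.length → ℝ × ℝ)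
      (rot : Fin L.length → Bool), IsRotPacking L pos rot ∧ areaRotCost L pos rot = c } := by
    rintro _ ⟨pos', rot', h', rfl⟩
    exact harea ▸ h'.sum_area_le hL hp
  exact le_antisymm ((csInf_le ⟨_, hlb⟩ ⟨pos, rot, h, rfl⟩).trans hle)
    (le_csInf ⟨_, pos, rot, h, rfl⟩ hlb)

theorem disjoint_interior_placedRect_of_fst_le {p p' : Piece} {q q' : ℝ × ℝ}
    (h : q.1 + p.1 ≤ q'.1) :
    Disjoint (interior (placedRect p q)) (interior (placedRect p' q')) := by
  rw [interior_placedRect, interior_placedRect, Set.disjoint_left]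
  rintro x ⟨⟨-, h1⟩, -⟩ ⟨⟨h2, -⟩, -⟩
  linarith

theorem disjoint_interior_placedRect_of_snd_le {p p' : Piece} {q q' : ℝ × ℝ}
    (h : q.2 + p.2 ≤ q'.2) :
    Disjoint (interior (placedRect p q)) (interior (placedRect p' q')) := by
  rw [interior_placedRect, interior_placedRect, Set.disjoint_left]
  rintro x ⟨-, ⟨-, h1⟩⟩ ⟨-, ⟨h2, -⟩⟩
  linarith

theorem isRotPacking_of_lt {L : List Piece} {pos : Fin L.length → ℝ × ℝ}
    {rot : Fin L.length → Bool}
    (h : ∀ i j : Fin L.length, i < j →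
      Disjoint (interior (placedRect (orient (L.get i) (rot i)) (pos i)))
        (interior (placedRect (orient (L.get j) (rot j)) (pos j)))) :
    IsRotPacking L pos rot := fun i j hij =>
  hij.lt_or_gt.elim (h i j) fun hji => (h j i hji).symm

/-! ### Two streams with a common prefix of thin pieces -/

theorem get_replicate_append_singleton (N : ℕ) (a p : Piece)
    (i : Fin (List.replicate N a ++ [p]).length) :
    (List.replicate N a ++ [p]).get i = if (i : ℕ) < N then a else p := by
  simp only [List.get_eq_getElem, List.getElem_append, List.length_replicate,
    List.getElem_replicate, List.getElem_singleton, dite_eq_ite]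

theorem piecePos_of_mem_replicate_append_singleton {N : ℕ} {a p : Piece} (ha : PiecePos a)
    (hp : PiecePos p) : ∀ x ∈ List.replicate N a ++ [p], PiecePos x := by
  intro x hx
  rcases List.mem_append.1 hx with hx | hx
  · rwa [List.eq_of_mem_replicate hx]
  · rwa [List.mem_singleton.1 hx]

/-- `N` equal pieces side by side, below a piece spanning all of them. -/
theorem optRotArea_replicate_row {N : ℕ} (hN : 0 < N) {w h h' : ℝ} (hw : 0 < w) (hh : 0 < h)
    (hh' : 0 < h') :
    optRotArea (List.replicate N (w, h) ++ [(N * w, h')]) = N * w * (h + h') := by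
  have hN' : (0 : ℝ) < N := Nat.cast_pos.2 hN
  let pos : Fin (List.replicate N (w, h) ++ [(N * w, h')]).length → ℝ × ℝ :=
    fun i => if (i : ℕ) < N then (i * w, 0) else (0, h)
  refine optRotArea_eq_of_tiling (pos := pos) (rot := fun _ => false) (b := (N * w, h + h'))
    (by simp) (piecePos_of_mem_replicate_append_singleton ⟨hw, hh⟩ ⟨by positivity, hh'⟩)
    (isRotPacking_of_lt fun i j hij => ?_) ⟨by positivity, by positivity⟩ 0
    (iUnion_subset fun i => ?_) ?_
  · have hj : (j : ℕ) < N + 1 := by simpa using j.isLt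
    have hi : (i : ℕ) < N := by have := Fin.lt_def.1 hij; omega
    rw [get_replicate_append_singleton, get_replicate_append_singleton]
    simp only [orient, pos, hi, if_true, Bool.false_eq_true, if_false]
    by_cases hjN : (j : ℕ) < N
    · simp only [hjN, if_true]
      refine disjoint_interior_placedRect_of_fst_le ?_
      have : (i : ℝ) + 1 ≤ j := by exact_mod_cast Fin.lt_def.1 hij
      simp only
      nlinarith
    · simp only [hjN, if_false]
      exact disjoint_interior_placedRect_of_snd_le (by simp)
  · rw [get_replicate_append_singleton]
    simp only [orient, pos, Bool.false_eq_true, if_false]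
    by_cases hi : (i : ℕ) < N
    · simp only [hi, if_true, placedRect]
      have hi' : (i : ℝ) + 1 ≤ N := by exact_mod_cast hi
      refine prod_mono (Icc_subset_Icc ?_ ?_) (Icc_subset_Icc ?_ ?_) <;> simp only [Prod.fst_zero,
        Prod.snd_zero]
      · positivity
      · nlinarith
      · exact le_rfl
      · linarith
    · simp only [hi, if_false, placedRect]
      refine prod_mono (Icc_subset_Icc ?_ ?_) (Icc_subset_Icc ?_ ?_) <;> simp only [Prod.fst_zero,
        Prod.snd_zero] <;> linarith
  · simp only [List.map_append, List.map_replicate, List.sum_append, List.sum_replicate,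
      List.map_singleton, List.sum_singleton, nsmul_eq_mul]
    ring

/-- `N` equal pieces stacked on top of each other, below a piece of the same width. -/
theorem optRotArea_replicate_column (N : ℕ) {w h h' : ℝ} (hw : 0 < w) (hh : 0 < h)
    (hh' : 0 < h') :
    optRotArea (List.replicate N (w, h) ++ [(w, h')]) = w * (N * h + h') := by
  let pos : Fin (List.replicate N (w, h) ++ [(w, h')]).length → ℝ × ℝ := fun i => (0, i * h)
  refine optRotArea_eq_of_tiling (pos := pos) (rot := fun _ => false) (b := (w, N * h + h'))
    (by simp) (piecePos_of_mem_replicate_append_singleton ⟨hw, hh⟩ ⟨hw, hh'⟩)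
    (isRotPacking_of_lt fun i j hij => ?_) ⟨hw, by positivity⟩ 0
    (iUnion_subset fun i => ?_) ?_
  · have hj : (j : ℕ) < N + 1 := by simpa using j.isLt
    have hi : (i : ℕ) < N := by have := Fin.lt_def.1 hij; omega
    rw [get_replicate_append_singleton, get_replicate_append_singleton]
    simp only [orient, pos, hi, if_true, Bool.false_eq_true, if_false]
    refine disjoint_interior_placedRect_of_snd_le ?_
    have : (i : ℝ) + 1 ≤ j := by exact_mod_cast Fin.lt_def.1 hij
    simp only
    nlinarith
  · rw [get_replicate_append_singleton]
    simp only [orient, pos, Bool.false_eq_true, if_false, placedRect]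
    have hi1 : (i : ℕ) < N + 1 := by simpa using i.isLt
    by_cases hi : (i : ℕ) < N
    · simp only [hi, if_true]
      have hi' : (i : ℝ) + 1 ≤ N := by exact_mod_cast hi
      refine prod_mono (Icc_subset_Icc ?_ ?_) (Icc_subset_Icc ?_ ?_) <;> simp only [Prod.fst_zero,
        Prod.snd_zero]
      · exact le_rfl
      · exact le_rfl
      · positivity
      · nlinarith
    · have hi' : (i : ℕ) = N := by omega
      simp only [hi', lt_irrefl, if_false]
      refine prod_mono (Icc_subset_Icc ?_ ?_) (Icc_subset_Icc ?_ ?_) <;> simp only [Prod.fst_zero,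
        Prod.snd_zero]
      · exact le_rfl
      · exact le_rfl
      · positivity
      · linarith
  · simp only [List.map_append, List.map_replicate, List.sum_append, List.sum_replicate,
      List.map_singleton, List.sum_singleton, nsmul_eq_mul]
    ring

/-! ### Extending a stream by one piece -/

/-- The set covered by the strategy `σ` on the stream `L`. -/
abbrev onlineRotSet (σ : List Piece → (ℝ × ℝ) × Bool) (L : List Piece) : Set (ℝ × ℝ) :=
  packedRotSet L (onlineRotPos σ L) (onlineRot σ L)

theorem onlineRotSet_subset_append (σ : List Piece → (ℝ × ℝ) × Bool) (P : List Piece)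
    (p : Piece) : onlineRotSet σ P ⊆ onlineRotSet σ (P ++ [p]) := by
  refine iUnion_subset fun i => ?_
  let j : Fin (P ++ [p]).length := ⟨i, by simp⟩
  refine subset_trans (Eq.subset ?_) (subset_iUnion (fun j => placedRect
    (orient ((P ++ [p]).get j) (onlineRot σ (P ++ [p]) j)) (onlineRotPos σ (P ++ [p]) j)) j)
  have ht : (P ++ [p]).take ((j : ℕ) + 1) = P.take ((i : ℕ) + 1) :=
    List.take_append_of_le_length i.isLt
  have hg : (P ++ [p]).get j = P.get i := List.getElem_append_left i.isLt
  simp only [onlineRot, onlineRotPos, ht, hg]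

theorem exists_placedRect_subset_onlineRotSet_append (σ : List Piece → (ℝ × ℝ) × Bool)
    (P : List Piece) (p : Piece) :
    ∃ r q, placedRect (orient p r) q ⊆ onlineRotSet σ (P ++ [p]) := by
  let j : Fin (P ++ [p]).length := ⟨P.length, by simp⟩
  have hg : (P ++ [p]).get j = p := by simp [j]
  refine ⟨onlineRot σ (P ++ [p]) j, onlineRotPos σ (P ++ [p]) j,
    subset_trans (Eq.subset ?_) (subset_iUnion (fun j => placedRect
    (orient ((P ++ [p]).get j) (onlineRot σ (P ++ [p]) j)) (onlineRotPos σ (P ++ [p]) j)) j)⟩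
  simp only [hg]

/-- The bounding box after adding a piece `p` contains both the old bounding box and a copy of
`p` in one of the two orientations. -/
theorem boxWidth_boxHeight_append_bounds (σ : List Piece → (ℝ × ℝ) × Bool) {P : List Piece}
    (hP : P ≠ []) (hpos : ∀ x ∈ P, PiecePos x) {p : Piece} (hp : PiecePos p) :
    boxWidth (onlineRotSet σ P) ≤ boxWidth (onlineRotSet σ (P ++ [p])) ∧
    boxHeight (onlineRotSet σ P) ≤ boxHeight (onlineRotSet σ (P ++ [p])) ∧
    ((p.1 ≤ boxWidth (onlineRotSet σ (P ++ [p])) ∧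
        p.2 ≤ boxHeight (onlineRotSet σ (P ++ [p]))) ∨
      (p.2 ≤ boxWidth (onlineRotSet σ (P ++ [p])) ∧
        p.1 ≤ boxHeight (onlineRotSet σ (P ++ [p])))) := by
  have hc : IsCompact (onlineRotSet σ (P ++ [p])) := isCompact_packedRotSet _ _ _
  have hne : (onlineRotSet σ P).Nonempty := nonempty_packedRotSet hP hpos _ _
  have hsub := onlineRotSet_subset_append σ P p
  obtain ⟨r, q, hr⟩ := exists_placedRect_subset_onlineRotSet_append σ P p
  have hrpos := hp.orient r
  have hw := boxWidth_mono (nonempty_placedRect hrpos q) hc hr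
  have hh := boxHeight_mono (nonempty_placedRect hrpos q) hc hr
  rw [boxWidth_placedRect hrpos] at hw
  rw [boxHeight_placedRect hrpos] at hh
  refine ⟨boxWidth_mono hne hc hsub, boxHeight_mono hne hc hsub, ?_⟩
  cases r
  · exact Or.inl ⟨hw, hh⟩
  · exact Or.inr ⟨hw, hh⟩

/-- For every valid online rotation strategy `σ`, every function
`f : ℝ → ℝ` and every real `c > 0`, there exists a nonempty finite stream `L`
of pieces with `OPT(L) = c` and `ALG_σ(L) > f(OPT(L)) * OPT(L)` (area of the
bounding box, rotations by 90° allowed). -/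
theorem area_rotation_no_opt_function_bound
    (σ : List Piece → (ℝ × ℝ) × Bool) (hσ : RotStrategyValid σ)
    (f : ℝ → ℝ) (c : ℝ) (hc : 0 < c) :
    ∃ L : List Piece, L ≠ [] ∧ (∀ p ∈ L, PiecePos p) ∧
      optRotArea L = c ∧ f (optRotArea L) * optRotArea L < algRotArea σ L := by
  set M : ℝ := |f c * c|
  have hfM : f c * c ≤ M := le_abs_self _
  have hM0 : 0 ≤ M := abs_nonneg _
  set m : ℝ := min 1 (c / 2)
  have hm0 : 0 < m := lt_min one_pos (by linarith)
  set K : ℝ := 2 * (M + 1) / c with hK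
  have hK0 : 0 < K := by positivity
  obtain ⟨N, hN⟩ := exists_nat_gt (K * (M + 1) / m)
  have hNr : (0 : ℝ) < N := lt_of_le_of_lt (by positivity) hN
  have hN0 : 0 < N := Nat.cast_pos.1 hNr
  set δ : ℝ := c / (2 * N) with hδ
  have hδ0 : 0 < δ := by positivity
  have hNδ : N * δ = c / 2 := by rw [hδ]; field_simp
  have hKc : K * c = 2 * (M + 1) := by rw [hK]; field_simp
  have hKN : K * (M + 1) < N * m := (div_lt_iff₀ hm0).1 hN
  have hthin : PiecePos ((1 : ℝ), δ) := ⟨one_pos, hδ0⟩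
  set P : List Piece := List.replicate N (1, δ) with hPdef
  have hP : P ≠ [] := by simp [hPdef, hN0.ne']
  have hPpos : ∀ x ∈ P, PiecePos x := fun x hx => by rwa [List.eq_of_mem_replicate hx]
  have harea : N * δ ≤ boxWidth (onlineRotSet σ P) * boxHeight (onlineRotSet σ P) := by
    refine le_of_eq_of_le ?_ ((hσ P hPpos).sum_area_le hP hPpos)
    simp [hPdef]
  set W := boxWidth (onlineRotSet σ P)
  set H := boxHeight (onlineRotSet σ P)
  have hW0 : 0 ≤ W :=
    boxWidth_nonneg (isCompact_packedRotSet _ _ _) (nonempty_packedRotSet hP hPpos _ _)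
  have hH0 : 0 ≤ H :=
    boxHeight_nonneg (isCompact_packedRotSet _ _ _) (nonempty_packedRotSet hP hPpos _ _)
  by_cases hWH : K * δ ≤ W ∧ K * δ ≤ H
  · have hp : PiecePos ((N : ℝ) * 1, δ) := ⟨by positivity, hδ0⟩
    have hopt : optRotArea (P ++ [((N : ℝ) * 1, δ)]) = c := by
      rw [hPdef, optRotArea_replicate_row hN0 one_pos hδ0 hδ0]
      linarith
    refine ⟨P ++ [((N : ℝ) * 1, δ)], by simp, piecePos_of_mem_replicate_append_singleton hthin hp,
      hopt, ?_⟩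
    rw [hopt]
    obtain ⟨hw, hh, hlong⟩ := boxWidth_boxHeight_append_bounds σ hP hPpos hp
    have hlarge : M + 1 = N * (K * δ) := by linear_combination -(1 / 2) * hKc - K * hNδ
    have hKδ : 0 ≤ K * δ := by positivity
    refine lt_of_lt_of_le (b := N * (K * δ)) (by linarith) ?_
    simp only [mul_one] at hlong hw hh ⊢
    rcases hlong with ⟨h1, -⟩ | ⟨-, h1⟩
    · exact mul_le_mul h1 (hWH.2.trans hh) hKδ (hNr.le.trans h1)
    · rw [mul_comm]
      exact mul_le_mul (hWH.1.trans hw) h1 hNr.le (hKδ.trans (hWH.1.trans hw))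
  · have hp : PiecePos ((1 : ℝ), c / 2) := ⟨one_pos, by positivity⟩
    have hopt : optRotArea (P ++ [(1, c / 2)]) = c := by
      rw [hPdef, optRotArea_replicate_column N one_pos hδ0 hp.2]
      linarith
    refine ⟨P ++ [(1, c / 2)], by simp, piecePos_of_mem_replicate_append_singleton hthin hp,
      hopt, ?_⟩
    rw [hopt]
    obtain ⟨hw, hh, hfat⟩ := boxWidth_boxHeight_append_bounds σ hP hPpos hp
    have hm1 : m ≤ 1 := min_le_left _ _
    have hm2 : m ≤ c / 2 := min_le_right _ _
    have hmw : m ≤ boxWidth (onlineRotSet σ (P ++ [(1, c / 2)])) :=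
      hfat.elim (fun h => hm1.trans h.1) fun h => hm2.trans h.1
    have hmh : m ≤ boxHeight (onlineRotSet σ (P ++ [(1, c / 2)])) :=
      hfat.elim (fun h => hm2.trans h.2) fun h => hm1.trans h.2
    have hlong {x y : ℝ} (hx : 0 ≤ x) (hy : y ≤ K * δ) (hxy : N * δ ≤ x * y) : N ≤ K * x := by
      refine le_of_mul_le_mul_right ?_ hδ0
      calc N * δ ≤ x * y := hxy
        _ ≤ x * (K * δ) := mul_le_mul_of_nonneg_left hy hx
        _ = K * x * δ := by ring
    have hlarge {x : ℝ} (hx : N ≤ K * x) : M + 1 ≤ x * m := by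
      refine le_of_mul_le_mul_left ?_ hK0
      calc K * (M + 1) ≤ N * m := hKN.le
        _ ≤ K * x * m := mul_le_mul_of_nonneg_right hx hm0.le
        _ = K * (x * m) := by ring
    refine lt_of_lt_of_le (b := M + 1) (by linarith) ?_
    rcases not_and_or.1 hWH with h | h
    · refine (hlarge (hlong hH0 (not_le.1 h).le (by linarith))).trans ?_
      rw [mul_comm]
      exact mul_le_mul hmw hh hH0 (hm0.le.trans hmw)
    · exact (hlarge (hlong hW0 (not_le.1 h).le harea)).trans
        (mul_le_mul hw hmh hm0.le (hW0.trans hw))
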